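/- Let x ∈ D ⊆ 𝒟 with E_f(x) ∈ J satisfy ‖x − T(x)‖ ⪯ γ(E_f(x))·‖W_f(x)‖, where γ : J → ℝ₊ is such that ψ(t) = 1 − b·t·γ(t) is positive on J, and let μ(t) = 1 − t·γ(t). Then, writing x̂ = T(x), σ_i(x) = Σ_{j≠i} W_j(x)/(x_i − x_j) and σ̂_i(x) = Σ_{j≠i} W_j(x)/(x̂_i − x_j), one has for every i: |σ_i(x) − σ̂_i(x)| ≤ a·γ(E_f(x))·E_f(x)²/μ(E_f(x)). (Theorem 2.1 (vi)) -/

import Mathlib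

open Finset Polynomial Filter

noncomputable section

/-- The Weierstrass correction `W_i(x) = f(x_i)/(C₀ ∏_{j≠i}(x_i − x_j))`. -/
def Wc {n : ℕ} {K : Type*} [NormedField K] (f : Polynomial K) (x : Fin n → K) (i : Fin n) : K :=
  eval (x i) f / (f.leadingCoeff * ∏ j ∈ univ.erase i, (x i - x j))

/-- `dmin x i = min_{j ≠ i} ‖x i - x j‖`. -/
def dmin {n : ℕ} {K : Type*} [NormedField K] (x : Fin n → K) (i : Fin n) : ℝ :=
  if h : (univ.erase i).Nonempty then (univ.erase i).inf' h fun j => ‖x i - x j‖ else 0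

/-- `E_f(x)` : the ℓ^p norm of the vector `(‖W_i(x)‖ / d_i(x))_i`. -/
def Ef {n : ℕ} {K : Type*} [NormedField K] (p : ENNReal) (f : Polynomial K)
    (x : Fin n → K) : ℝ :=
  ‖(WithLp.equiv p (Fin n → ℝ)).symm (fun i => ‖Wc f x i‖ / dmin x i)‖

/-- `σ_i(x) = Σ_{j≠i} W_j(x)/(x_i − x_j)`. -/
def sigmaf {n : ℕ} {K : Type*} [NormedField K] (f : Polynomial K) (x : Fin n → K)
    (i : Fin n) : K :=
  ∑ j ∈ univ.erase i, Wc f x j / (x i - x j)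

/-- The Ehrlich iteration function. -/
def PhiE {n : ℕ} {K : Type*} [NormedField K] (f : Polynomial K) (x : Fin n → K) : Fin n → K :=
  fun i => x i - Wc f x i / (1 + sigmaf f x i)

/-- The Prešić–Tanabe iteration function. -/
def TnbE {n : ℕ} {K : Type*} [NormedField K] (f : Polynomial K) (x : Fin n → K) : Fin n → K :=
  fun i => x i - Wc f x i * (1 - sigmaf f x i)

/-- `ξ` is a root vector of `f`, i.e. `f(z) = C₀ ∏ (z − ξᵢ)`. -/
def IsRootVector {n : ℕ} {K : Type*} [NormedField K] (f : Polynomial K) (ξ : Fin n → K) : Prop :=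
  f = C f.leadingCoeff * ∏ i, (X - C (ξ i))

/-- `E_f(x)` in the case `p = ∞`: the max of `‖W_i(x)‖ / d_i(x)`. -/
def Einf {n : ℕ} {K : Type*} [NormedField K] (f : Polynomial K) (x : Fin n → K) : ℝ :=
  if h : (univ : Finset (Fin n)).Nonempty then univ.sup' h fun i => ‖Wc f x i‖ / dmin x i else 0

theorem sum_le_card_rpow_mul_norm {ι : Type*} [Fintype ι] {p q : ENNReal} (hp : 1 ≤ p)
    (hpq : p⁻¹ + q⁻¹ = 1) (s : Finset ι) (e : ι → ℝ) (he : ∀ i, 0 ≤ e i) :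
    ∑ j ∈ s, e j ≤ (#s : ℝ) ^ (ENNReal.toReal q⁻¹) * ‖(WithLp.toLp p e : PiLp p fun _ => ℝ)‖ := by
  have : Fact (1 ≤ p) := ⟨hp⟩
  have hle (i : ι) : e i ≤ ‖(WithLp.toLp p e : PiLp p fun _ => ℝ)‖ := by
    simpa [abs_of_nonneg (he i)] using PiLp.norm_apply_le (WithLp.toLp p e : PiLp p fun _ => ℝ) i
  rcases eq_or_ne p ⊤ with rfl | hp_top
  · have hq : q⁻¹ = 1 := by simpa using hpq
    rw [hq, ENNReal.toReal_one, Real.rpow_one, ← nsmul_eq_mul]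
    exact sum_le_card_nsmul _ _ _ fun i _ => hle i
  · have hr : 1 ≤ p.toReal := by
      simpa using ENNReal.toReal_mono hp_top hp
    have hr0 : 0 < p.toReal := by linarith
    have hq_top : q⁻¹ ≠ ⊤ := fun h => by simp [h] at hpq
    have hp_inv : p⁻¹ ≠ ⊤ := ENNReal.inv_ne_top.2 (zero_lt_one.trans_le hp).ne'
    have hq : (q⁻¹).toReal = (p.toReal - 1) * (1 / p.toReal) := by
      have h := congrArg ENNReal.toReal hpq
      rw [ENNReal.toReal_add hp_inv hq_top, ENNReal.toReal_inv, ENNReal.toReal_one] at h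
      field_simp at h ⊢
      linarith
    have hS : 0 ≤ ∑ j ∈ s, e j := sum_nonneg fun i _ => he i
    have hT : 0 ≤ ∑ j, e j ^ p.toReal := sum_nonneg fun i _ => Real.rpow_nonneg (he i) _
    have hpow : (∑ j ∈ s, e j) ^ p.toReal ≤
        (#s : ℝ) ^ (p.toReal - 1) * ∑ j, e j ^ p.toReal :=
      (Real.rpow_sum_le_const_mul_sum_rpow_of_nonneg s hr fun i _ => he i).trans <|
        mul_le_mul_of_nonneg_left
          (sum_le_sum_of_subset_of_nonneg (subset_univ s) fun i _ _ => Real.rpow_nonneg (he i) _)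
          (by positivity)
    have hroot := Real.rpow_le_rpow (by positivity) hpow (one_div_nonneg.2 hr0.le)
    rw [← Real.rpow_mul hS, mul_one_div_cancel hr0.ne', Real.rpow_one,
      Real.mul_rpow (by positivity) hT, ← Real.rpow_mul (by positivity), ← hq] at hroot
    rw [PiLp.norm_eq_sum hr0]
    simpa [abs_of_nonneg, he] using hroot

theorem dmin_le {n : ℕ} {K : Type*} [NormedField K] (x : Fin n → K) {i j : Fin n} (hij : j ≠ i) :
    dmin x i ≤ ‖x i - x j‖ := by
  have hj : j ∈ univ.erase i := by simp [hij]
  rw [dmin, dif_pos ⟨j, hj⟩]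
  exact inf'_le _ hj

theorem dmin_nonneg {n : ℕ} {K : Type*} [NormedField K] (x : Fin n → K) (i : Fin n) :
    0 ≤ dmin x i := by
  unfold dmin
  split_ifs with h
  · exact le_inf' _ _ fun j _ => norm_nonneg _
  · exact le_rfl

theorem dmin_pos {n : ℕ} {K : Type*} [NormedField K] {x : Fin n → K} (hx : Function.Injective x)
    {i j : Fin n} (hij : j ≠ i) : 0 < dmin x i := by
  have hne : (univ.erase i).Nonempty := ⟨j, by simp [hij]⟩
  rw [dmin, dif_pos hne]
  refine (lt_inf'_iff hne).2 fun k hk => ?_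
  exact norm_pos_iff.2 (sub_ne_zero.2 (hx.ne (ne_of_mem_erase hk).symm))

/-- Moving the centre `u` to `v` changes `c / (u - w)` by a controlled amount. -/
theorem norm_div_sub_div_le {K : Type*} [NormedField K] {c u v w : K} {d e g t : ℝ}
    (hd : 0 < d) (hduw : d ≤ ‖u - w‖) (he : 0 ≤ e) (hc : ‖c‖ ≤ e * ‖u - w‖) (hgt : g * t < 1)
    (huv : ‖u - v‖ ≤ g * t * d) :
    ‖c / (u - w) - c / (v - w)‖ ≤ e * (g * t / (1 - t * g)) := by
  have huw : 0 < ‖u - w‖ := hd.trans_le hduw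
  have hμ : 0 < 1 - t * g := by linarith [mul_comm t g]
  have hvw : (1 - t * g) * d ≤ ‖v - w‖ := by
    have := norm_sub_le_norm_sub_add_norm_sub u v w
    linarith [mul_comm t g]
  have hvw0 : 0 < ‖v - w‖ := (mul_pos hμ hd).trans_le hvw
  have huw' : u - w ≠ 0 := norm_pos_iff.1 huw
  have hvw' : v - w ≠ 0 := norm_pos_iff.1 hvw0
  have hkey : c / (u - w) - c / (v - w) = c / (u - w) * ((v - u) / (v - w)) := by
    field_simp
    ring
  have hgt0 : 0 ≤ g * t * d := (norm_nonneg _).trans huv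
  rw [hkey, norm_mul, norm_div, norm_div, norm_sub_rev v u]
  refine mul_le_mul ((div_le_iff₀ huw).2 hc) ?_ (by positivity) he
  calc ‖u - v‖ / ‖v - w‖ ≤ g * t * d / ((1 - t * g) * d) := by gcongr
    _ = g * t / (1 - t * g) := mul_div_mul_right _ _ hd.ne'

/-- Proinov, Theorem 2.1 (vi). -/
theorem stmt_4 {n : ℕ} {K : Type*} [NormedField K] [CompleteSpace K] (hn : 2 ≤ n)
    (f : Polynomial K) (hdeg : f.degree = (n : ℕ))
    (p q : ENNReal) (hp : 1 ≤ p) (hpq : p⁻¹ + q⁻¹ = 1)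
    (a b : ℝ) (ha : a = ((n : ℝ) - 1) ^ (ENNReal.toReal q⁻¹))
    (hb : b = (2 : ℝ) ^ (ENNReal.toReal q⁻¹))
    (J : Set ℝ) (hJ0 : (0 : ℝ) ∈ J) (hJsub : J ⊆ Set.Ici (0 : ℝ)) (hJconn : J.OrdConnected)
    (γ : ℝ → ℝ) (hγ : ∀ t ∈ J, 0 ≤ γ t) (hψ : ∀ t ∈ J, 0 < 1 - b * t * γ t)
    (D : Set (Fin n → K)) (hD : ∀ y ∈ D, Function.Injective y)
    (T : (Fin n → K) → Fin n → K)
    (x : Fin n → K) (hxD : x ∈ D) (hxE : Ef p f x ∈ J)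
    (hmain : ∀ i, ‖x i - T x i‖ ≤ γ (Ef p f x) * ‖Wc f x i‖) :
    ∀ i : Fin n,
      ‖sigmaf f x i - ∑ j ∈ univ.erase i, Wc f x j / (T x i - x j)‖ ≤
        a * γ (Ef p f x) * Ef p f x ^ 2 / (1 - Ef p f x * γ (Ef p f x)) := by
  intro i
  have hinj := hD x hxD
  set E := Ef p f x
  set e : Fin n → ℝ := fun j => ‖Wc f x j‖ / dmin x j
  have he (j : Fin n) : 0 ≤ e j := div_nonneg (norm_nonneg _) (dmin_nonneg x j)
  have hE_norm : E = ‖(WithLp.toLp p e : PiLp p fun _ => ℝ)‖ := rfl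
  have hg : 0 ≤ γ E := hγ E hxE
  have hE0 : 0 ≤ E := hJsub hxE
  have heE : e i ≤ E := by
    have : Fact (1 ≤ p) := ⟨hp⟩
    rw [hE_norm]
    simpa [abs_of_nonneg (he i)] using PiLp.norm_apply_le (WithLp.toLp p e : PiLp p fun _ => ℝ) i
  have hb1 : 1 ≤ b := hb ▸ Real.one_le_rpow one_le_two ENNReal.toReal_nonneg
  have hμ : γ E * E < 1 := by
    nlinarith [hψ E hxE, mul_nonneg (sub_nonneg.2 hb1) (mul_nonneg hE0 hg)]
  have hW {j k : Fin n} (hkj : k ≠ j) : ‖Wc f x j‖ = e j * dmin x j :=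
    (div_mul_cancel₀ _ (dmin_pos hinj hkj).ne').symm
  have hsum : ∑ j ∈ univ.erase i, e j ≤ a * E := by
    have h := sum_le_card_rpow_mul_norm hp hpq (univ.erase i) e he
    rwa [card_erase_of_mem (mem_univ i), card_univ, Fintype.card_fin,
      Nat.cast_pred (by omega), ← ha, ← hE_norm] at h
  have hterm : ∀ j ∈ univ.erase i, ‖Wc f x j / (x i - x j) - Wc f x j / (T x i - x j)‖ ≤
      e j * (γ E * E / (1 - E * γ E)) := by
    intro j hj
    have hji := ne_of_mem_erase hj
    have hd := dmin_pos hinj hji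
    refine norm_div_sub_div_le hd (dmin_le x hji) (he j) ?_ hμ ?_
    · rw [hW hji.symm, norm_sub_rev]
      exact mul_le_mul_of_nonneg_left (dmin_le x hji.symm) (he j)
    · refine (hmain i).trans ?_
      rw [hW hji, ← mul_assoc]
      gcongr
  rw [sigmaf, ← sum_sub_distrib]
  calc _ ≤ ∑ j ∈ univ.erase i, e j * (γ E * E / (1 - E * γ E)) := norm_sum_le_of_le _ hterm
    _ ≤ a * E * (γ E * E / (1 - E * γ E)) := by
      rw [← sum_mul]
      have : 0 ≤ 1 - E * γ E := by linarith [mul_comm E (γ E)]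
      gcongr
    _ = _ := by ring
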